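/- arXiv:gr-qc/0401081 — 5 statements merged into one kernel-verified Lean document; each statement's English description precedes it below -/
import Mathlib

section
/- Let E be a real inner product space, let a, b, x, y be real numbers and c, z ∈ E such that a² + b² + ‖c‖² = 1, x² + y² + ‖z‖² = 1, and a·x + b·y + ⟪c, z⟫ = 0. Then (a·y − b·x)² + ‖a•z − x•c‖² + ‖b•z − y•c‖² + ‖c‖²·‖z‖² − ⟪c, z⟫² = 1. -/
open RealInnerProductSpace

/-- The squared norm of a difference of scalar multiples, expanded. -/
theorem norm_smul_sub_smul_sq_real {E : Type*} [NormedAddCommGroup E] [InnerProductSpace ℝ E]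
    (s t : ℝ) (c z : E) :
    ‖s • z - t • c‖ ^ 2 = s ^ 2 * ‖z‖ ^ 2 - 2 * (s * t * ⟪c, z⟫) + t ^ 2 * ‖c‖ ^ 2 := by
  rw [norm_sub_sq_real, real_inner_smul_left, real_inner_smul_right, real_inner_comm,
    norm_smul, norm_smul, mul_pow, mul_pow, Real.norm_eq_abs, Real.norm_eq_abs, sq_abs, sq_abs]
  ring

theorem kottler_coefficients_sum_to_one
    {E : Type*} [NormedAddCommGroup E] [InnerProductSpace ℝ E]
    (a b x y : ℝ) (c z : E)
    (hU : a ^ 2 + b ^ 2 + ‖c‖ ^ 2 = 1)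
    (hW : x ^ 2 + y ^ 2 + ‖z‖ ^ 2 = 1)
    (hUW : a * x + b * y + ⟪c, z⟫ = 0) :
    (a * y - b * x) ^ 2 + ‖a • z - x • c‖ ^ 2 + ‖b • z - y • c‖ ^ 2
      + ‖c‖ ^ 2 * ‖z‖ ^ 2 - ⟪c, z⟫ ^ 2 = 1 := by
  rw [norm_smul_sub_smul_sq_real, norm_smul_sub_smul_sq_real]
  linear_combination (x ^ 2 + y ^ 2 + ‖z‖ ^ 2) * hU + hW - (a * x + b * y + ⟪c, z⟫) * hUW
end

section
/- Let E be a real inner product space, let a, b, x, y, α, β, γ be real numbers and c, z ∈ E such that a² + b² + ‖c‖² = 1, x² + y² + ‖z‖² = 1, and a·x + b·y + ⟪c, z⟫ = 0. Then min(α, min(β, γ)) ≤ α·(a·y − b·x)² + β·(‖a•z − x•c‖² + ‖b•z − y•c‖²) + γ·(‖c‖²·‖z‖² − ⟪c, z⟫²) ≤ max(α, max(β, γ)). -/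
open RealInnerProductSpace

/-- Lagrange's identity for the vectors `(a, b, c)` and `(x, y, z)` of `ℝ × ℝ × E`. -/
theorem lagrange_identity_prod {E : Type*} [NormedAddCommGroup E] [InnerProductSpace ℝ E]
    (a b x y : ℝ) (c z : E) :
    (a * y - b * x) ^ 2 + (‖a • z - x • c‖ ^ 2 + ‖b • z - y • c‖ ^ 2)
        + (‖c‖ ^ 2 * ‖z‖ ^ 2 - ⟪c, z⟫ ^ 2)
      = (a ^ 2 + b ^ 2 + ‖c‖ ^ 2) * (x ^ 2 + y ^ 2 + ‖z‖ ^ 2)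
        - (a * x + b * y + ⟪c, z⟫) ^ 2 := by
  simp only [norm_sub_sq_real, norm_smul, mul_pow, Real.norm_eq_abs, sq_abs,
    real_inner_smul_left, real_inner_smul_right, real_inner_comm c z]
  ring

/-- A convex combination of three reals lies between their minimum and their maximum. -/
theorem weighted_sum_mem_Icc_min_max (α β γ : ℝ) {p q r : ℝ}
    (hp : 0 ≤ p) (hq : 0 ≤ q) (hr : 0 ≤ r) (hsum : p + q + r = 1) :
    min α (min β γ) ≤ α * p + β * q + γ * r
      ∧ α * p + β * q + γ * r ≤ max α (max β γ) := by
  constructor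
  · calc min α (min β γ)
        = min α (min β γ) * p + min α (min β γ) * q + min α (min β γ) * r := by
          rw [← mul_add, ← mul_add, hsum, mul_one]
      _ ≤ α * p + β * q + γ * r := by gcongr <;> simp
  · calc α * p + β * q + γ * r
        ≤ max α (max β γ) * p + max α (max β γ) * q + max α (max β γ) * r := by
          gcongr <;> simp
      _ = max α (max β γ) := by rw [← mul_add, ← mul_add, hsum, mul_one]

theorem kottler_sectional_curvature_two_sided_bound
    {E : Type*} [NormedAddCommGroup E] [InnerProductSpace ℝ E]
    (a b x y α β γ : ℝ) (c z : E)
    (hU : a ^ 2 + b ^ 2 + ‖c‖ ^ 2 = 1)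
    (hW : x ^ 2 + y ^ 2 + ‖z‖ ^ 2 = 1)
    (hUW : a * x + b * y + ⟪c, z⟫ = 0) :
    min α (min β γ)
      ≤ α * (a * y - b * x) ^ 2
        + β * (‖a • z - x • c‖ ^ 2 + ‖b • z - y • c‖ ^ 2)
        + γ * (‖c‖ ^ 2 * ‖z‖ ^ 2 - ⟪c, z⟫ ^ 2)
    ∧ α * (a * y - b * x) ^ 2
        + β * (‖a • z - x • c‖ ^ 2 + ‖b • z - y • c‖ ^ 2)
        + γ * (‖c‖ ^ 2 * ‖z‖ ^ 2 - ⟪c, z⟫ ^ 2)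
      ≤ max α (max β γ) := by
  have hsum := lagrange_identity_prod a b x y c z
  rw [hU, hW, hUW] at hsum
  have hP : 0 ≤ (a * y - b * x) ^ 2 := sq_nonneg _
  have hQ : 0 ≤ ‖a • z - x • c‖ ^ 2 + ‖b • z - y • c‖ ^ 2 := by positivity
  have hR : 0 ≤ ‖c‖ ^ 2 * ‖z‖ ^ 2 - ⟪c, z⟫ ^ 2 := by
    rw [← mul_pow, sub_nonneg]
    exact sq_le_sq' (neg_le_of_abs_le (abs_real_inner_le_norm c z)) (real_inner_le_norm c z)
  exact weighted_sum_mem_Icc_min_max α β γ hP hQ hR (by linarith)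
end

section
/- Let n ≥ 4 be an integer and let r be a real number with √((n−3)/(n−1)) < r < 1. Then μ_n(r) < 0 and |μ_n(r)|·r^{−(n−1)} < 1/(n−3). -/
theorem kottler_negative_mass_nonpositive_curvature_criterion
    (n : ℕ) (hn : 4 ≤ n) (r : ℝ)
    (hr1 : Real.sqrt (((n : ℝ) - 3) / ((n : ℝ) - 1)) < r) (hr2 : r < 1) :
    (r ^ (n - 1) - r ^ (n - 3)) / 2 < 0
    ∧ |(r ^ (n - 1) - r ^ (n - 3)) / 2| / r ^ (n - 1) < 1 / ((n : ℝ) - 3) := by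
  have hr0 : 0 < r := (Real.sqrt_nonneg _).trans_lt hr1
  have hn' : (4 : ℝ) ≤ n := by exact_mod_cast hn
  have hsq : (n : ℝ) - 3 < r ^ 2 * (n - 1) :=
    (div_lt_iff₀ (by linarith)).mp ((Real.sqrt_lt' hr0).mp hr1)
  have hpow : r ^ (n - 1) = r ^ (n - 3) * r ^ 2 := by
    rw [← pow_add]
    congr 1
    omega
  have hp : 0 < r ^ (n - 3) := pow_pos hr0 _
  have hneg : (r ^ (n - 1) - r ^ (n - 3)) / 2 < 0 := by
    rw [hpow]
    linarith [mul_lt_of_lt_one_right hp (pow_lt_one₀ hr0.le hr2 two_ne_zero)]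
  refine ⟨hneg, ?_⟩
  rw [abs_of_neg hneg, hpow, div_lt_div_iff₀ (by positivity) (by linarith)]
  nlinarith [mul_lt_mul_of_pos_left hsq hp]
end

section
/- Let n ≥ 5 be an integer, let r₊ be a real number with 1 ≤ r₊ ≤ √(n(n−3)/((n−1)(n−4))), and set m = μ_n(r₊). Then for every real r ≥ r₊, −1 − (n−3)·m·r^{−(n−1)} ≥ −2(n−1)/n. -/
theorem kottler_nondegenerate_curvature_lower_bound
    (n : ℕ) (hn : 5 ≤ n) (rp : ℝ) (hrp1 : 1 ≤ rp)
    (hrp2 : rp ≤ Real.sqrt ((n : ℝ) * ((n : ℝ) - 3) / (((n : ℝ) - 1) * ((n : ℝ) - 4))))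
    (m : ℝ) (hm : m = (rp ^ (n - 1) - rp ^ (n - 3)) / 2) :
    ∀ r : ℝ, rp ≤ r →
      -1 - ((n : ℝ) - 3) * m / r ^ (n - 1) ≥ -2 * ((n : ℝ) - 1) / (n : ℝ) := by
  intro r hr
  have hx : (5 : ℝ) ≤ n := by exact_mod_cast hn
  have hden : (0 : ℝ) < ((n : ℝ) - 1) * ((n : ℝ) - 4) := mul_pos (by linarith) (by linarith)
  have hsq : rp ^ 2 * (((n : ℝ) - 1) * ((n : ℝ) - 4)) ≤ (n : ℝ) * ((n : ℝ) - 3) := by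
    rw [← le_div_iff₀ hden]
    exact (Real.le_sqrt' (by linarith)).1 hrp2
  have hpow : rp ^ (n - 1) = rp ^ (n - 3) * rp ^ 2 := by
    rw [← pow_add]
    congr 1
    omega
  have hmono : rp ^ (n - 1) ≤ r ^ (n - 1) := pow_le_pow_left₀ (by linarith) hr _
  have hhorizon : ((n : ℝ) - 3) * m * n ≤ ((n : ℝ) - 2) * rp ^ (n - 1) := by
    have h := mul_le_mul_of_nonneg_left hsq (pow_nonneg (zero_le_one.trans hrp1) (n - 3))
    rw [hm, hpow]
    linarith
  have hbound : ((n : ℝ) - 3) * m / r ^ (n - 1) ≤ ((n : ℝ) - 2) / n := by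
    rw [div_le_div_iff₀ (pow_pos (by linarith) _) (by linarith)]
    exact hhorizon.trans (mul_le_mul_of_nonneg_left hmono (by linarith))
  have hsplit : -2 * ((n : ℝ) - 1) / n = -1 - ((n : ℝ) - 2) / n := by
    field_simp
    ring
  linarith
end

section
/- Let n ≥ 4 be an integer, let r₊ be a real number with √((n−3)/(n−1)) ≤ r₊ < 1, and set m = μ_n(r₊), so m ≤ 0. Then for every real r ≥ r₊, −1 + (n−3)·|m|·r^{−(n−1)} ≤ 0. -/
theorem kottler_negative_mass_nonpositive_curvature
    (n : ℕ) (hn : 4 ≤ n) (rp : ℝ)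
    (hrp1 : Real.sqrt (((n : ℝ) - 3) / ((n : ℝ) - 1)) ≤ rp) (hrp2 : rp < 1)
    (m : ℝ) (hm : m = (rp ^ (n - 1) - rp ^ (n - 3)) / 2) :
    m ≤ 0
    ∧ ∀ r : ℝ, rp ≤ r →
        -1 + ((n : ℝ) - 3) * |m| / r ^ (n - 1) ≤ 0 := by
  have hn' : (4 : ℝ) ≤ n := by exact_mod_cast hn
  have hrp : 0 < rp :=
    (Real.sqrt_pos.mpr (div_pos (by linarith) (by linarith))).trans_le hrp1
  have hsq : (n : ℝ) - 3 ≤ rp ^ 2 * ((n : ℝ) - 1) :=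
    (div_le_iff₀ (by linarith)).mp ((Real.sqrt_le_left hrp.le).mp hrp1)
  have hpow : rp ^ (n - 1) = rp ^ (n - 3) * rp ^ 2 := by
    rw [← pow_add]
    congr 1
    omega
  have hm0 : m ≤ 0 := by
    have hle : rp ^ (n - 1) ≤ rp ^ (n - 3) :=
      pow_le_pow_of_le_one hrp.le hrp2.le (by omega)
    linarith
  refine ⟨hm0, fun r hr => ?_⟩
  have hbound : ((n : ℝ) - 3) * |m| ≤ r ^ (n - 1) := by
    calc ((n : ℝ) - 3) * |m|
        = rp ^ (n - 3) * (((n : ℝ) - 3) * (1 - rp ^ 2) / 2) := by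
          rw [abs_of_nonpos hm0, hm, hpow]
          ring
      _ ≤ rp ^ (n - 3) * rp ^ 2 := by
          gcongr
          linarith
      _ = rp ^ (n - 1) := hpow.symm
      _ ≤ r ^ (n - 1) := by gcongr
  have hdiv := div_le_one_of_le₀ hbound (pow_pos (hrp.trans_le hr) _).le
  linarith
end
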